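/- Full-meet multi-agent belief revision satisfies the generalized Consistency 1 postulate: for every pointed Kripke model (M,s) with belief set K = K_{(M,s)}, every agent a ∈ A and every propositionally satisfiable propositional formula φ, B_a ⊥ ∉ K *_fm B_a φ; equivalently, the designated world of the pointed Kripke model representing K *_fm B_a φ has at least one R_a-successor. -/

import Mathlib

/-- Propositional formulas over a set of propositions `P` (no modalities). -/
inductive PForm (P : Type) : Type
  | atom : P → PForm P
  | neg : PForm P → PForm P
  | and : PForm P → PForm P → PForm P
  | or : PForm P → PForm P → PForm P

/-- Classical satisfaction of a propositional formula by a truth assignment `v ⊆ P`. -/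
def PForm.sat {P : Type} (v : Set P) : PForm P → Prop
  | PForm.atom p => p ∈ v
  | PForm.neg φ => ¬ PForm.sat v φ
  | PForm.and φ ψ => PForm.sat v φ ∧ PForm.sat v ψ
  | PForm.or φ ψ => PForm.sat v φ ∨ PForm.sat v ψ

/-- Belief formulas over agents `A` and propositions `P`. -/
inductive BForm (A P : Type) : Type
  | atom : P → BForm A P
  | neg : BForm A P → BForm A P
  | and : BForm A P → BForm A P → BForm A P
  | or : BForm A P → BForm A P → BForm A P
  | bel : A → BForm A P → BForm A P

/-- Embedding of propositional formulas into belief formulas. -/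
def PForm.toB {A P : Type} : PForm P → BForm A P
  | PForm.atom p => BForm.atom p
  | PForm.neg φ => BForm.neg (PForm.toB φ)
  | PForm.and φ ψ => BForm.and (PForm.toB φ) (PForm.toB ψ)
  | PForm.or φ ψ => BForm.or (PForm.toB φ) (PForm.toB ψ)

/-- A multi-agent Kripke model: worlds, accessibility relations, valuation. -/
structure Kripke (A P : Type) where
  W : Type
  R : A → W → W → Prop
  val : W → Set P

/-- Satisfaction of a belief formula at a world of a Kripke model. -/
def Kripke.sat {A P : Type} (M : Kripke A P) : M.W → BForm A P → Prop
  | w, BForm.atom p => p ∈ M.val w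
  | w, BForm.neg φ => ¬ M.sat w φ
  | w, BForm.and φ ψ => M.sat w φ ∧ M.sat w ψ
  | w, BForm.or φ ψ => M.sat w φ ∨ M.sat w ψ
  | w, BForm.bel a φ => ∀ t, M.R a w t → M.sat t φ

/-- A pointed Kripke model. -/
structure PKripke (A P : Type) where
  M : Kripke A P
  s : M.W

/-- Membership of a belief formula in the belief set of a pointed Kripke model. -/
def PKripke.sat {A P : Type} (K : PKripke A P) (φ : BForm A P) : Prop :=
  K.M.sat K.s φ

/-- First-degree subset relation between the belief sets of two pointed Kripke models. -/
def fdSub {A P : Type} (K₁ K₂ : PKripke A P) : Prop :=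
  ∀ (a : A) (φ : PForm P),
    K₁.sat (BForm.bel a (PForm.toB φ)) → K₂.sat (BForm.bel a (PForm.toB φ))

/-- The expansion of the Kripke model `M` at `s` by the belief `B_a φ`:
worlds are the originals `Sum.inl u`, the replicas `Sum.inr (Sum.inl u)`, and the
fresh designated world `Sum.inr (Sum.inr ())`. -/
def Kripke.expand {A P : Type} (M : Kripke A P) (s : M.W) (a : A) (φ : PForm P) :
    Kripke A P where
  W := M.W ⊕ (M.W ⊕ Unit)
  R := fun x w v =>
    match w, v with
    | Sum.inl u, Sum.inl v => M.R x u v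
    | Sum.inr (Sum.inl u), Sum.inr (Sum.inl v) =>
        M.R x u v ∧ (x = a → PForm.sat (M.val v) φ)
    | Sum.inr (Sum.inr _), Sum.inl v => x ≠ a ∧ M.R x s v
    | Sum.inr (Sum.inr _), Sum.inr (Sum.inl v) =>
        x = a ∧ M.R a s v ∧ PForm.sat (M.val v) φ
    | _, _ => False
  val := fun w =>
    match w with
    | Sum.inl u => M.val u
    | Sum.inr (Sum.inl u) => M.val u
    | Sum.inr (Sum.inr _) => M.val s

/-- Expansion of a pointed Kripke model by `B_a φ`. -/
def PKripke.expand {A P : Type} (K : PKripke A P) (a : A) (φ : PForm P) : PKripke A P :=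
  ⟨K.M.expand K.s a φ, Sum.inr (Sum.inr ())⟩

/-- The generic minimal Kripke model: worlds `2^P`, total accessibility, identity valuation. -/
def Kripke.minimal (A P : Type) : Kripke A P where
  W := Set P
  R := fun _ _ _ => True
  val := id

open Classical in
/-- Full-meet multi-agent belief revision of a pointed Kripke model by `B_a φ`. -/
noncomputable def PKripke.fm {A P : Type} (K : PKripke A P) (a : A) (φ : PForm P) :
    PKripke A P :=
  if K.sat (BForm.bel a (PForm.toB (PForm.neg φ)))
  then PKripke.expand ⟨Kripke.minimal A P, K.M.val K.s⟩ a φ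
  else K.expand a φ

theorem Kripke.sat_toB {A P : Type} (M : Kripke A P) (w : M.W) (φ : PForm P) :
    M.sat w φ.toB ↔ φ.sat (M.val w) := by
  induction φ with
  | atom p => rfl
  | neg φ ih => simp only [PForm.toB, Kripke.sat, PForm.sat, ih]
  | and φ ψ ihφ ihψ => simp only [PForm.toB, Kripke.sat, PForm.sat, ihφ, ihψ]
  | or φ ψ ihφ ihψ => simp only [PForm.toB, Kripke.sat, PForm.sat, ihφ, ihψ]

theorem PKripke.exists_expand_succ {A P : Type} (K : PKripke A P) (a : A) (φ : PForm P)
    (h : ∃ v, K.M.R a K.s v ∧ φ.sat (K.M.val v)) :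
    ∃ u, (K.expand a φ).M.R a (K.expand a φ).s u := by
  obtain ⟨v, hR, hφ⟩ := h
  exact ⟨Sum.inr (Sum.inl v), rfl, hR, hφ⟩

theorem fm_consistency1 {A P : Type} [Fintype A] [Nonempty A] [Fintype P]
    (K : PKripke A P) (a : A) (φ : PForm P)
    (hφ : ∃ v : Set P, PForm.sat v φ) :
    ∃ u, (K.fm a φ).M.R a (K.fm a φ).s u := by
  by_cases h : K.sat (BForm.bel a (PForm.toB (PForm.neg φ)))
  · rw [PKripke.fm, if_pos h]
    obtain ⟨v, hv⟩ := hφ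
    exact PKripke.exists_expand_succ ⟨Kripke.minimal A P, K.M.val K.s⟩ a φ ⟨v, trivial, hv⟩
  · rw [PKripke.fm, if_neg h]
    apply PKripke.exists_expand_succ
    contrapose! h
    exact fun t ht => (K.M.sat_toB t φ.neg).2 (h t ht)
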